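/- arXiv:1402.4944 — 4 statements merged into one kernel-verified Lean document; each statement's English description precedes it below -/
import Mathlib

section
/- Let X = MD(G, S0, S1, T0, T1) be a strongly connected mixed Cayley digraph with λ(X) < δ(X). Then any two distinct positive λ-atoms of X are vertex disjoint, and any two distinct negative λ-atoms of X are vertex disjoint. -/
open Set Pointwise

/-- Arc relation of the mixed Cayley digraph `MD(G,S0,S1,T0,T1)` on vertex set
`G × Bool`, where `false` plays the role of the index `0` and `true` of `1`. -/
def MDArc {G : Type*} [Group G] (S0 S1 T0 T1 : Set G) (u v : G × Bool) : Prop :=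
  (u.2 = false ∧ v.2 = false ∧ ∃ s ∈ S0, v.1 = s * u.1) ∨
  (u.2 = true ∧ v.2 = true ∧ ∃ s ∈ S1, v.1 = s * u.1) ∨
  (u.2 = false ∧ v.2 = true ∧ ∃ t ∈ T0, v.1 = t * u.1) ∨
  (u.2 = true ∧ v.2 = false ∧ ∃ t ∈ T1, u.1 = t * v.1)

/-- A digraph (given by its arc relation) is strongly connected if every vertex
is reachable from every other vertex by a directed path. -/
def DigraphStronglyConnected {V : Type*} (R : V → V → Prop) : Prop :=
  ∀ u v : V, Relation.ReflTransGen R u v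

/-- Out-degree of a vertex: the number of arcs originating at it. -/
noncomputable def outDegree {V : Type*} (R : V → V → Prop) (v : V) : ℕ :=
  {w | R v w}.ncard

/-- In-degree of a vertex: the number of arcs terminating at it. -/
noncomputable def inDegree {V : Type*} (R : V → V → Prop) (v : V) : ℕ :=
  {w | R w v}.ncard

/-- `δ`: the minimum, over all vertices, of in-degrees and out-degrees. -/
noncomputable def minDegree {V : Type*} (R : V → V → Prop) : ℕ :=
  sInf {n | ∃ v, n = outDegree R v ∨ n = inDegree R v}

/-- `W` is an arc-disconnecting set: a set of arcs whose deletion leaves a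
digraph that is not strongly connected. -/
def IsDisconnectingArcSet {V : Type*} (R : V → V → Prop) (W : Set (V × V)) : Prop :=
  (∀ p ∈ W, R p.1 p.2) ∧
  ¬ DigraphStronglyConnected (fun u v => R u v ∧ (u, v) ∉ W)

/-- The arc connectivity `λ`: the minimum cardinality of an arc-disconnecting set. -/
noncomputable def arcConnectivity {V : Type*} (R : V → V → Prop) : ℕ :=
  sInf {n | ∃ W : Set (V × V), IsDisconnectingArcSet R W ∧ W.ncard = n}

/-- `ω⁺(A)`: the set of arcs from `A` to its complement. -/
def omegaPlus {V : Type*} (R : V → V → Prop) (A : Set V) : Set (V × V) :=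
  {p | R p.1 p.2 ∧ p.1 ∈ A ∧ p.2 ∉ A}

/-- `ω⁻(A)`: the set of arcs from the complement of `A` to `A`. -/
def omegaMinus {V : Type*} (R : V → V → Prop) (A : Set V) : Set (V × V) :=
  {p | R p.1 p.2 ∧ p.1 ∉ A ∧ p.2 ∈ A}

/-- A positive arc fragment: a proper nonempty vertex subset with `|ω⁺(A)| = λ`. -/
def IsPosFragment {V : Type*} (R : V → V → Prop) (A : Set V) : Prop :=
  A.Nonempty ∧ A ≠ Set.univ ∧ (omegaPlus R A).ncard = arcConnectivity R

/-- A negative arc fragment: a proper nonempty vertex subset with `|ω⁻(A)| = λ`. -/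
def IsNegFragment {V : Type*} (R : V → V → Prop) (A : Set V) : Prop :=
  A.Nonempty ∧ A ≠ Set.univ ∧ (omegaMinus R A).ncard = arcConnectivity R

/-- An arc fragment: a positive or negative arc fragment. -/
def IsArcFragment {V : Type*} (R : V → V → Prop) (A : Set V) : Prop :=
  IsPosFragment R A ∨ IsNegFragment R A

/-- A `λ`-atom: an arc fragment of least possible cardinality. -/
def IsLambdaAtom {V : Type*} (R : V → V → Prop) (A : Set V) : Prop :=
  IsArcFragment R A ∧ ∀ B, IsArcFragment R B → A.ncard ≤ B.ncard

/-- A positive `λ`-atom: a positive arc fragment of least possible cardinality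
among all arc fragments. -/
def IsPosLambdaAtom {V : Type*} (R : V → V → Prop) (A : Set V) : Prop :=
  IsPosFragment R A ∧ ∀ B, IsArcFragment R B → A.ncard ≤ B.ncard

/-- A negative `λ`-atom: a negative arc fragment of least possible cardinality
among all arc fragments. -/
def IsNegLambdaAtom {V : Type*} (R : V → V → Prop) (A : Set V) : Prop :=
  IsNegFragment R A ∧ ∀ B, IsArcFragment R B → A.ncard ≤ B.ncard

/-- A `λ`-superatom: an arc fragment with at least two vertices, of least
possible cardinality among arc fragments with at least two vertices. -/
def IsLambdaSuperatom {V : Type*} (R : V → V → Prop) (A : Set V) : Prop :=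
  IsArcFragment R A ∧ 2 ≤ A.ncard ∧
    ∀ B, IsArcFragment R B → 2 ≤ B.ncard → A.ncard ≤ B.ncard

/-- A positive `λ`-superatom. -/
def IsPosLambdaSuperatom {V : Type*} (R : V → V → Prop) (A : Set V) : Prop :=
  IsPosFragment R A ∧ 2 ≤ A.ncard ∧
    ∀ B, IsArcFragment R B → 2 ≤ B.ncard → A.ncard ≤ B.ncard

/-- A negative `λ`-superatom. -/
def IsNegLambdaSuperatom {V : Type*} (R : V → V → Prop) (A : Set V) : Prop :=
  IsNegFragment R A ∧ 2 ≤ A.ncard ∧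
    ∀ B, IsArcFragment R B → 2 ≤ B.ncard → A.ncard ≤ B.ncard

/-- The set of out-arcs of a vertex. -/
def outArcsOf {V : Type*} (R : V → V → Prop) (v : V) : Set (V × V) :=
  {p | R p.1 p.2 ∧ p.1 = v}

/-- The set of in-arcs of a vertex. -/
def inArcsOf {V : Type*} (R : V → V → Prop) (v : V) : Set (V × V) :=
  {p | R p.1 p.2 ∧ p.2 = v}

/-- A digraph is super-`λ` if every minimum arc-disconnecting set is the set of
in-arcs of some vertex or the set of out-arcs of some vertex. -/
def SuperLambda {V : Type*} (R : V → V → Prop) : Prop :=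
  ∀ W : Set (V × V), IsDisconnectingArcSet R W → W.ncard = arcConnectivity R →
    (∃ v, W = outArcsOf R v) ∨ (∃ v, W = inArcsOf R v)

theorem omegaMinus_eq_omegaPlus_compl {V : Type*} (R : V → V → Prop) (A : Set V) :
    omegaMinus R A = omegaPlus R Aᶜ := by
  ext p
  simp [omegaMinus, omegaPlus]

/-- The out-cut function of a finite digraph is submodular. -/
theorem ncard_omegaPlus_inter_add_union_le {V : Type*} [Finite V] (R : V → V → Prop)
    (A B : Set V) :
    (omegaPlus R (A ∩ B)).ncard + (omegaPlus R (A ∪ B)).ncard ≤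
      (omegaPlus R A).ncard + (omegaPlus R B).ncard := by
  rw [← Set.ncard_union_add_ncard_inter (omegaPlus R (A ∩ B)),
    ← Set.ncard_union_add_ncard_inter (omegaPlus R A)]
  refine add_le_add (Set.ncard_le_ncard ?_) (Set.ncard_le_ncard ?_)
  all_goals
    intro p
    simp only [omegaPlus, Set.mem_union, Set.mem_inter_iff, Set.mem_ofPred_eq]
    tauto

/-- The in-cut function of a finite digraph is submodular. -/
theorem ncard_omegaMinus_inter_add_union_le {V : Type*} [Finite V] (R : V → V → Prop)
    (A B : Set V) :
    (omegaMinus R (A ∩ B)).ncard + (omegaMinus R (A ∪ B)).ncard ≤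
      (omegaMinus R A).ncard + (omegaMinus R B).ncard := by
  simp only [omegaMinus_eq_omegaPlus_compl, Set.compl_inter, Set.compl_union]
  have := ncard_omegaPlus_inter_add_union_le R Aᶜ Bᶜ
  omega

theorem arcConnectivity_le_ncard_omegaPlus {V : Type*} (R : V → V → Prop) {A : Set V}
    (hne : A.Nonempty) (huniv : A ≠ Set.univ) :
    arcConnectivity R ≤ (omegaPlus R A).ncard := by
  refine Nat.sInf_le ⟨omegaPlus R A, ⟨fun p hp => hp.1, fun h => ?_⟩, rfl⟩
  obtain ⟨u, hu⟩ := hne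
  obtain ⟨v, hv⟩ := (Set.ne_univ_iff_exists_notMem A).1 huniv
  have hreach := h u v
  clear h
  refine hv ?_
  clear hv
  induction hreach with
  | refl => exact hu
  | tail _ hxy ih => exact by_contra fun hy => hxy.2 ⟨hxy.1, ih, hy⟩

theorem arcConnectivity_le_ncard_omegaMinus {V : Type*} (R : V → V → Prop) {A : Set V}
    (hne : A.Nonempty) (huniv : A ≠ Set.univ) :
    arcConnectivity R ≤ (omegaMinus R A).ncard := by
  rw [omegaMinus_eq_omegaPlus_compl]
  exact arcConnectivity_le_ncard_omegaPlus R (Set.nonempty_compl.2 huniv)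
    (by simpa [Set.compl_univ_iff] using hne.ne_empty)

theorem IsPosFragment.compl {V : Type*} {R : V → V → Prop} {A : Set V}
    (h : IsPosFragment R A) : IsNegFragment R Aᶜ :=
  ⟨Set.nonempty_compl.2 h.2.1, by simpa [Set.compl_univ_iff] using h.1.ne_empty, by
    simpa [omegaMinus_eq_omegaPlus_compl] using h.2.2⟩

theorem IsNegFragment.compl {V : Type*} {R : V → V → Prop} {A : Set V}
    (h : IsNegFragment R A) : IsPosFragment R Aᶜ :=
  ⟨Set.nonempty_compl.2 h.2.1, by simpa [Set.compl_univ_iff] using h.1.ne_empty, by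
    simpa [omegaMinus_eq_omegaPlus_compl] using h.2.2⟩

/-- Two distinct minimizers, over the proper nonempty sets, of a submodular set function are
disjoint, provided that they have the least cardinality among the minimizers and at most half
of the points each. -/
theorem inter_eq_empty_of_submodular {V : Type*} [Finite V] {f : Set V → ℕ} {k : ℕ}
    (hsub : ∀ A B, f (A ∩ B) + f (A ∪ B) ≤ f A + f B)
    (hk : ∀ A : Set V, A.Nonempty → A ≠ Set.univ → k ≤ f A) {A B : Set V}
    (hA : f A = k) (hB : f B = k)
    (hAmin : ∀ C : Set V, C.Nonempty → C ≠ Set.univ → f C = k → A.ncard ≤ C.ncard)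
    (hBmin : ∀ C : Set V, C.Nonempty → C ≠ Set.univ → f C = k → B.ncard ≤ C.ncard)
    (hAc : A.ncard ≤ Aᶜ.ncard) (hBc : B.ncard ≤ Bᶜ.ncard) (hAB : A ≠ B) :
    A ∩ B = ∅ := by
  by_contra hne
  have hinter : (A ∩ B).Nonempty := Set.nonempty_iff_ne_empty.2 hne
  have hcardA := Set.ncard_add_ncard_compl A
  have hcardB := Set.ncard_add_ncard_compl B
  have hcard := Set.ncard_union_add_ncard_inter A B
  have hpos := (Set.ncard_pos).2 hinter
  have hunion : A ∪ B ≠ Set.univ := by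
    intro h
    rw [h, Set.ncard_univ] at hcard
    omega
  have hinter_univ : A ∩ B ≠ Set.univ := fun h =>
    hunion (Set.eq_univ_of_subset (Set.inter_subset_left.trans Set.subset_union_left) h)
  have h₁ := hk _ hinter hinter_univ
  have h₂ := hk _ (hinter.mono (Set.inter_subset_left.trans Set.subset_union_left)) hunion
  have h₃ := hsub A B
  have hfk : f (A ∩ B) = k := by omega
  exact hAB ((Set.eq_of_subset_of_ncard_le Set.inter_subset_left
    (hAmin _ hinter hinter_univ hfk)).symm.trans
    (Set.eq_of_subset_of_ncard_le Set.inter_subset_right (hBmin _ hinter hinter_univ hfk)))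

theorem IsPosLambdaAtom.inter_eq_empty {V : Type*} [Finite V] {R : V → V → Prop} {A B : Set V}
    (hA : IsPosLambdaAtom R A) (hB : IsPosLambdaAtom R B) (hAB : A ≠ B) : A ∩ B = ∅ :=
  inter_eq_empty_of_submodular (ncard_omegaPlus_inter_add_union_le R)
    (fun _ => arcConnectivity_le_ncard_omegaPlus R) hA.1.2.2 hB.1.2.2
    (fun C h₁ h₂ h₃ => hA.2 C (Or.inl ⟨h₁, h₂, h₃⟩))
    (fun C h₁ h₂ h₃ => hB.2 C (Or.inl ⟨h₁, h₂, h₃⟩))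
    (hA.2 _ (Or.inr hA.1.compl)) (hB.2 _ (Or.inr hB.1.compl)) hAB

theorem IsNegLambdaAtom.inter_eq_empty {V : Type*} [Finite V] {R : V → V → Prop} {A B : Set V}
    (hA : IsNegLambdaAtom R A) (hB : IsNegLambdaAtom R B) (hAB : A ≠ B) : A ∩ B = ∅ :=
  inter_eq_empty_of_submodular (ncard_omegaMinus_inter_add_union_le R)
    (fun _ => arcConnectivity_le_ncard_omegaMinus R) hA.1.2.2 hB.1.2.2
    (fun C h₁ h₂ h₃ => hA.2 C (Or.inr ⟨h₁, h₂, h₃⟩))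
    (fun C h₁ h₂ h₃ => hB.2 C (Or.inr ⟨h₁, h₂, h₃⟩))
    (hA.2 _ (Or.inl hA.1.compl)) (hB.2 _ (Or.inl hB.1.compl)) hAB

/-- distinct positive (resp. negative) λ-atoms are vertex disjoint. -/
theorem mixedCayley_lambdaAtoms_disjoint
    {G : Type*} [Group G] [Fintype G] (S0 S1 T0 T1 : Set G)
    (hS0 : (1 : G) ∉ S0) (hS1 : (1 : G) ∉ S1)
    (hT0 : T0.Nonempty) (hT1 : T1.Nonempty)
    (hsc : DigraphStronglyConnected (MDArc S0 S1 T0 T1))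
    (hlt : arcConnectivity (MDArc S0 S1 T0 T1) < minDegree (MDArc S0 S1 T0 T1)) :
    (∀ A B : Set (G × Bool), IsPosLambdaAtom (MDArc S0 S1 T0 T1) A →
      IsPosLambdaAtom (MDArc S0 S1 T0 T1) B → A ≠ B → A ∩ B = ∅) ∧
    (∀ A B : Set (G × Bool), IsNegLambdaAtom (MDArc S0 S1 T0 T1) A →
      IsNegLambdaAtom (MDArc S0 S1 T0 T1) B → A ≠ B → A ∩ B = ∅) := by
  exact ⟨fun _ _ hA hB hAB => hA.inter_eq_empty hB hAB,
    fun _ _ hA hB hAB => hA.inter_eq_empty hB hAB⟩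
end

section
/- Let X = MD(G, S0, S1, T0, T1) be a strongly connected mixed Cayley digraph with λ(X) < δ(X), and let A be a λ-atom of X. Then the subdigraph of X induced by A is strongly connected. -/
open Set Pointwise

section Digraph

variable {V : Type*} {R : V → V → Prop} {A B : Set V} {u v : V}

/-- No walk leaves a set `B` that has no outgoing arcs. -/
theorem Relation.ReflTransGen.mem_of_closed (hB : ∀ x y, R x y → x ∈ B → y ∈ B)
    (h : Relation.ReflTransGen R u v) (hu : u ∈ B) : v ∈ B := by
  induction h with
  | refl => exact hu
  | tail _ hxy ih => exact hB _ _ hxy ih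

theorem arcConnectivity_le_ncard_omegaPlus_s3 (hu : u ∈ B) (hv : v ∉ B) :
    arcConnectivity R ≤ (omegaPlus R B).ncard := by
  refine Nat.sInf_le ⟨omegaPlus R B, ⟨fun p hp => hp.1, fun h => hv ?_⟩, rfl⟩
  refine (h u v).mem_of_closed (fun x y hxy hx => ?_) hu
  by_contra hy
  exact hxy.2 ⟨hxy.1, hx, hy⟩

theorem arcConnectivity_le_ncard_omegaMinus_s3 (hu : u ∈ B) (hv : v ∉ B) :
    arcConnectivity R ≤ (omegaMinus R B).ncard := by
  have h : omegaMinus R B = omegaPlus R Bᶜ := by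
    ext p
    simp [omegaMinus, omegaPlus]
  rw [h]
  exact arcConnectivity_le_ncard_omegaPlus_s3 (u := v) (v := u) hv (not_not_intro hu)

/-- The subdigraph induced by a `λ`-atom of any finite digraph is strongly connected. -/
theorem IsLambdaAtom.reflTransGen_induced [Finite V] (hA : IsLambdaAtom R A)
    (hu : u ∈ A) (hv : v ∈ A) :
    Relation.ReflTransGen (fun x y => R x y ∧ x ∈ A ∧ y ∈ A) u v := by
  by_contra huv
  set r : V → V → Prop := fun x y => R x y ∧ x ∈ A ∧ y ∈ A
  obtain ⟨hfrag, hmin⟩ := hA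
  let B : Set V := {w | w ∈ A ∧ Relation.ReflTransGen r u w}
  have huB : u ∈ B := ⟨hu, .refl⟩
  have hvB : v ∉ B := fun h => huv h.2
  have hclosed : ∀ x y, R x y → x ∈ B → y ∈ A → y ∈ B := fun x y hxy hx hy =>
    ⟨hy, hx.2.tail ⟨hxy, hx.1, hy⟩⟩
  rcases hfrag with ⟨-, -, hcard⟩ | ⟨-, -, hcard⟩
  · have hsub : omegaPlus R B ⊆ omegaPlus R A := fun p ⟨hp, h1, h2⟩ =>
      ⟨hp, h1.1, fun h => h2 (hclosed _ _ hp h1 h)⟩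
    have hB : IsPosFragment R B :=
      ⟨⟨u, huB⟩, fun h => hvB (h ▸ mem_univ v),
        (hcard ▸ ncard_le_ncard hsub (toFinite _)).antisymm
          (arcConnectivity_le_ncard_omegaPlus_s3 huB hvB)⟩
    have hlt : B.ncard < A.ncard :=
      ncard_lt_ncard ⟨fun x hx => hx.1, fun h => hvB (h hv)⟩ (toFinite _)
    exact hlt.not_ge (hmin B (.inl hB))
  · have hvC : v ∈ A \ B := ⟨hv, hvB⟩
    have huC : u ∉ A \ B := fun h => h.2 huB
    have hsub : omegaMinus R (A \ B) ⊆ omegaMinus R A := fun p ⟨hp, h1, h2⟩ =>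
      ⟨hp, fun h => h2.2 (hclosed _ _ hp (by_contra fun hB => h1 ⟨h, hB⟩) h2.1), h2.1⟩
    have hC : IsNegFragment R (A \ B) :=
      ⟨⟨v, hvC⟩, fun h => huC (h ▸ mem_univ u),
        (hcard ▸ ncard_le_ncard hsub (toFinite _)).antisymm
          (arcConnectivity_le_ncard_omegaMinus_s3 hvC huC)⟩
    have hlt : (A \ B).ncard < A.ncard :=
      ncard_lt_ncard ⟨fun x hx => hx.1, fun h => huC (h hu)⟩ (toFinite _)
    exact hlt.not_ge (hmin (A \ B) (.inr hC))

end Digraph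

/-- the subdigraph induced by a λ-atom is strongly connected. -/
theorem mixedCayley_lambdaAtom_induced_stronglyConnected
    {G : Type*} [Group G] [Fintype G] (S0 S1 T0 T1 : Set G)
    (hS0 : (1 : G) ∉ S0) (hS1 : (1 : G) ∉ S1)
    (hT0 : T0.Nonempty) (hT1 : T1.Nonempty)
    (hsc : DigraphStronglyConnected (MDArc S0 S1 T0 T1))
    (hlt : arcConnectivity (MDArc S0 S1 T0 T1) < minDegree (MDArc S0 S1 T0 T1))
    (A : Set (G × Bool)) (hA : IsLambdaAtom (MDArc S0 S1 T0 T1) A) :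
    ∀ u ∈ A, ∀ v ∈ A,
      Relation.ReflTransGen
        (fun x y => MDArc S0 S1 T0 T1 x y ∧ x ∈ A ∧ y ∈ A) u v := by
  exact fun u hu v hv => hA.reflTransGen_induced hu hv
end

section
/- Let X = MD(G, S0, S1, T0, T1) be a strongly connected mixed Cayley digraph with λ(X) < δ(X), and let A be a λ-atom of X. Then |A| ≥ δ(X) + 1. -/
open Set Pointwise

/-- In a loopless digraph, a vertex set of size `a` whose vertices all have out-degree at least `d`
emits at least `a * (d - (a - 1))` arcs. -/
theorem ncard_mul_succ_le_ncard_omegaPlus_add {V : Type*} [Finite V] {R : V → V → Prop}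
    (hR : ∀ v, ¬ R v v) {d : ℕ} {A : Set V} (hd : ∀ v ∈ A, d ≤ outDegree R v) :
    A.ncard * (d + 1) ≤ (omegaPlus R A).ncard + A.ncard * A.ncard := by
  classical
  have := Fintype.ofFinite V
  have hdeg : ∀ v ∈ A.toFinset, d + 1 ≤ {w | R v w ∧ w ∉ A}.ncard + A.ncard := by
    intro v hv
    have hv : v ∈ A := by simpa using hv
    have hsub : {w | R v w} ⊆ {w | R v w ∧ w ∉ A} ∪ (A \ {v}) := by
      intro w hw
      by_cases hwA : w ∈ A
      · exact Or.inr ⟨hwA, fun h => hR v (by rw [mem_singleton_iff] at h; subst h; exact hw)⟩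
      · exact Or.inl ⟨hw, hwA⟩
    have h₁ := (ncard_le_ncard hsub).trans (ncard_union_le _ _)
    have h₂ := ncard_sdiff_singleton_add_one hv
    have h₃ : d ≤ {w | R v w}.ncard := hd v hv
    lia
  have hcard : (omegaPlus R A).ncard = ∑ v ∈ A.toFinset, {w | R v w ∧ w ∉ A}.ncard := by
    have hfin : omegaPlus R A =
        (A.toFinset.sigma fun v => {w | R v w ∧ w ∉ A}.toFinset).map
          (Equiv.sigmaEquivProd V V).toEmbedding := by
      ext ⟨u, w⟩
      simp [omegaPlus, and_left_comm]
    rw [hfin, ncard_coe_finset, Finset.card_map, Finset.card_sigma]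
    simp only [ncard_eq_toFinset_card']
  have hsum := Finset.sum_le_sum hdeg
  rwa [Finset.sum_const, Finset.sum_add_distrib, ← hcard, Finset.sum_const,
    ← ncard_eq_toFinset_card', smul_eq_mul, smul_eq_mul] at hsum

/-- In a loopless digraph with all out-degrees at least `d`, a nonempty vertex set emitting fewer
than `d` arcs has more than `d` vertices. -/
theorem lt_ncard_of_ncard_omegaPlus_lt {V : Type*} [Finite V] {R : V → V → Prop}
    (hR : ∀ v, ¬ R v v) {d : ℕ} {A : Set V} (hA : A.Nonempty)
    (hd : ∀ v ∈ A, d ≤ outDegree R v) (hlt : (omegaPlus R A).ncard < d) : d < A.ncard := by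
  by_contra! hle
  have hpos : 0 < A.ncard := hA.ncard_pos
  have := ncard_mul_succ_le_ncard_omegaPlus_add hR hd
  nlinarith

theorem ncard_omegaPlus_flip {V : Type*} (R : V → V → Prop) (A : Set V) :
    (omegaPlus (flip R) A).ncard = (omegaMinus R A).ncard := by
  have h : omegaPlus (flip R) A = Prod.swap '' omegaMinus R A := by
    ext ⟨u, w⟩
    simp [omegaPlus, omegaMinus, flip, and_comm]
  rw [h, ncard_image_of_injective _ Prod.swap_injective]

theorem minDegree_le_outDegree {V : Type*} (R : V → V → Prop) (v : V) :
    minDegree R ≤ outDegree R v :=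
  Nat.sInf_le ⟨v, Or.inl rfl⟩

theorem minDegree_le_inDegree {V : Type*} (R : V → V → Prop) (v : V) :
    minDegree R ≤ inDegree R v :=
  Nat.sInf_le ⟨v, Or.inr rfl⟩

/-- In a loopless digraph with `λ < δ`, every arc fragment has more than `δ` vertices. -/
theorem IsArcFragment.minDegree_lt_ncard {V : Type*} [Finite V] {R : V → V → Prop}
    (hR : ∀ v, ¬ R v v) (hlt : arcConnectivity R < minDegree R) {A : Set V}
    (hA : IsArcFragment R A) : minDegree R < A.ncard := by
  obtain ⟨hne, -, hcard⟩ | ⟨hne, -, hcard⟩ := hA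
  · exact lt_ncard_of_ncard_omegaPlus_lt hR hne (fun v _ => minDegree_le_outDegree R v)
      (hcard ▸ hlt)
  · exact lt_ncard_of_ncard_omegaPlus_lt (R := flip R) hR hne
      (fun v _ => minDegree_le_inDegree R v) (by rw [ncard_omegaPlus_flip, hcard]; exact hlt)

theorem not_mdArc_self {G : Type*} [Group G] {S0 S1 T0 T1 : Set G}
    (hS0 : (1 : G) ∉ S0) (hS1 : (1 : G) ∉ S1) (v : G × Bool) : ¬ MDArc S0 S1 T0 T1 v v := by
  rintro (⟨-, -, s, hs, h⟩ | ⟨-, -, s, hs, h⟩ | ⟨h₀, h₁, -⟩ | ⟨h₁, h₀, -⟩)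
  · exact hS0 (right_eq_mul.mp h ▸ hs)
  · exact hS1 (right_eq_mul.mp h ▸ hs)
  all_goals simp [h₀] at h₁

/-- a λ-atom has at least `δ(X) + 1` vertices. -/
theorem mixedCayley_lambdaAtom_card_ge
    {G : Type*} [Group G] [Fintype G] (S0 S1 T0 T1 : Set G)
    (hS0 : (1 : G) ∉ S0) (hS1 : (1 : G) ∉ S1)
    (hT0 : T0.Nonempty) (hT1 : T1.Nonempty)
    (hsc : DigraphStronglyConnected (MDArc S0 S1 T0 T1))
    (hlt : arcConnectivity (MDArc S0 S1 T0 T1) < minDegree (MDArc S0 S1 T0 T1))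
    (A : Set (G × Bool)) (hA : IsLambdaAtom (MDArc S0 S1 T0 T1) A) :
    minDegree (MDArc S0 S1 T0 T1) + 1 ≤ A.ncard := by
  exact hA.1.minDegree_lt_ncard (not_mdArc_self hS0 hS1) hlt
end

section
/- Let X = MD(G, S0, S1, T0, T1) be a strongly connected mixed Cayley digraph with λ(X) < δ(X), and let A be a λ-atom of X. Then |A ∩ X_i| ≥ 2 for i = 0 and i = 1, where X_i = G × {i}. -/
open Set Pointwise

theorem ncard_omegaMinus_eq_ncard_omegaPlus_flip {V : Type*} (R : V → V → Prop) (A : Set V) :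
    (omegaMinus R A).ncard = (omegaPlus (flip R) A).ncard := by
  rw [← Set.ncard_image_of_injective (omegaMinus R A) Prod.swap_injective]
  congr 1
  ext ⟨u, v⟩
  simp [omegaMinus, omegaPlus, flip, and_comm]

theorem not_stronglyConnected_of_closed {V : Type*} {R : V → V → Prop} {A : Set V}
    (hne : A.Nonempty) (huniv : A ≠ Set.univ) (hclosed : ∀ u v, R u v → u ∈ A → v ∈ A) :
    ¬ DigraphStronglyConnected R := by
  intro hsc
  obtain ⟨a, ha⟩ := hne
  refine huniv (Set.eq_univ_of_forall fun b => ?_)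
  induction hsc a b with
  | refl => exact ha
  | tail _ hbc ih => exact hclosed _ _ hbc ih

theorem omegaPlus_nonempty {V : Type*} {R : V → V → Prop} (hsc : DigraphStronglyConnected R)
    {A : Set V} (hne : A.Nonempty) (huniv : A ≠ Set.univ) : (omegaPlus R A).Nonempty := by
  by_contra hempty
  refine not_stronglyConnected_of_closed hne huniv (fun u v huv hu => ?_) hsc
  by_contra hv
  exact hempty ⟨(u, v), huv, hu, hv⟩

theorem ncard_mul_le_ncard_omegaPlus {V : Type*} [Finite V] (R : V → V → Prop) (A : Set V) (c : ℕ)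
    (hc : ∀ v ∈ A, c ≤ {w | R v w ∧ w ∉ A}.ncard) : A.ncard * c ≤ (omegaPlus R A).ncard := by
  classical
  have := Fintype.ofFinite V
  rw [Set.ncard_eq_toFinset_card' A, Set.ncard_eq_toFinset_card' (omegaPlus R A),
    Finset.card_eq_sum_card_fiberwise (f := Prod.fst) (t := A.toFinset)
      (fun p hp => by simpa using (Set.mem_toFinset.1 hp).2.1), ← smul_eq_mul]
  refine Finset.card_nsmul_le_sum _ _ _ fun v hv => (hc v (by simpa using hv)).trans ?_
  rw [← Set.ncard_coe_finset, ← Set.ncard_image_of_injective _ (Prod.mk_right_injective v)]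
  refine Set.ncard_le_ncard ?_
  rintro _ ⟨w, ⟨hvw, hw⟩, rfl⟩
  exact Finset.mem_filter.2 ⟨Set.mem_toFinset.2 ⟨hvw, Set.mem_toFinset.1 hv, hw⟩, rfl⟩

theorem outDegree_add_one_le {V : Type*} [Finite V] {R : V → V → Prop} {A : Set V} {v : V}
    (hloop : ¬ R v v) (hv : v ∈ A) :
    outDegree R v + 1 ≤ {w | R v w ∧ w ∉ A}.ncard + A.ncard := by
  have hsub : {w | R v w} ⊆ {w | R v w ∧ w ∉ A} ∪ (A \ {v}) := by
    intro w hw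
    by_cases hwA : w ∈ A
    · exact Or.inr ⟨hwA, fun h => hloop (by rw [Set.mem_singleton_iff] at h; exact h ▸ hw)⟩
    · exact Or.inl ⟨hw, hwA⟩
  have hle := (Set.ncard_le_ncard hsub).trans (Set.ncard_union_le _ _)
  have hdiff := Set.ncard_sdiff_singleton_add_one hv
  unfold outDegree
  omega

/-- If every vertex of `A` has an out-neighbour outside `A`, then at least `d` arcs leave `A`,
where `d` is a lower bound for the out-degrees of the loopless digraph. -/
theorem le_ncard_omegaPlus_of_forall_exists {V : Type*} [Finite V] {R : V → V → Prop}
    (hloop : ∀ v, ¬ R v v) {d : ℕ} (hdeg : ∀ v, d ≤ outDegree R v) {A : Set V}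
    (hne : A.Nonempty) (hout : ∀ v ∈ A, ∃ w, R v w ∧ w ∉ A) : d ≤ (omegaPlus R A).ncard := by
  have hpos : 0 < A.ncard := (Set.ncard_pos).2 hne
  rcases le_or_gt A.ncard d with hle | hgt
  · have hmul := ncard_mul_le_ncard_omegaPlus R A (d + 1 - A.ncard) fun v hv => by
      have := outDegree_add_one_le (hloop v) hv
      have := hdeg v
      omega
    obtain ⟨m, hm⟩ := Nat.exists_eq_add_of_le' hpos
    obtain ⟨k, rfl⟩ := Nat.exists_eq_add_of_le hle
    rw [show A.ncard + k + 1 - A.ncard = k + 1 by omega] at hmul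
    refine le_trans ?_ hmul
    rw [hm]
    nlinarith [Nat.zero_le (m * k)]
  · have hmul := ncard_mul_le_ncard_omegaPlus R A 1 fun v hv =>
      Nat.one_le_iff_ne_zero.2 ((Set.ncard_pos).2 (hout v hv)).ne'
    omega

/-- A minimal set among those with few outgoing arcs is mapped by every automorphism either to
itself or to a disjoint set. -/
theorem image_eq_of_inter_nonempty {V : Type*} [Finite V] {R : V → V → Prop} {l : ℕ}
    (hmin : ∀ B : Set V, B.Nonempty → B ≠ Set.univ → l ≤ (omegaPlus R B).ncard)
    {A : Set V} (hA : (omegaPlus R A).ncard = l)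
    (hatom : ∀ B : Set V, B.Nonempty → B ≠ Set.univ → (omegaPlus R B).ncard = l →
      A.ncard ≤ B.ncard)
    (hhalf : A.ncard ≤ Aᶜ.ncard) (e : V ≃ V) (he : ∀ u v, R (e u) (e v) ↔ R u v)
    (hne : (A ∩ e '' A).Nonempty) : e '' A = A := by
  have hcard : (e '' A).ncard = A.ncard := Set.ncard_image_of_injective A e.injective
  have heA : (omegaPlus R (e '' A)).ncard = l := by
    rw [← hA, ← Set.ncard_image_of_injective (omegaPlus R A) (e.prodCongr e).injective]
    congr 1
    ext ⟨u, v⟩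
    obtain ⟨u, rfl⟩ := e.surjective u
    obtain ⟨v, rfl⟩ := e.surjective v
    simp [omegaPlus, he]
  have hpos : 0 < (A ∩ e '' A).ncard := (Set.ncard_pos).2 hne
  have hui := Set.ncard_union_add_ncard_inter A (e '' A)
  have hcompl := Set.ncard_add_ncard_compl A
  have hunion : A ∪ e '' A ≠ Set.univ := by
    intro h
    rw [h, Set.ncard_univ] at hui
    omega
  have hinter : A ∩ e '' A ≠ Set.univ := fun h =>
    hunion (Set.eq_univ_of_univ_subset
      (h ▸ Set.inter_subset_left.trans Set.subset_union_left))
  have hsub := ncard_omegaPlus_inter_add_union_le R A (e '' A)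
  have hl1 := hmin _ hne hinter
  have hl2 := hmin _ (hne.mono (Set.inter_subset_left.trans Set.subset_union_left)) hunion
  have hle := hatom _ hne hinter (by omega)
  have hAeq : A ∩ e '' A = A := Set.eq_of_subset_of_ncard_le Set.inter_subset_left hle
  exact (Set.eq_of_subset_of_ncard_le (Set.inter_eq_left.1 hAeq) hcard.le).symm

/-- A minimal set with few outgoing arcs, in a loopless digraph on `G × Bool` that is invariant
under right translation and has out-arcs from every vertex to the other side, has at least two
vertices on each side. -/
theorem two_le_ncard_inter_side {G : Type*} [Group G] [Finite G] {R : G × Bool → G × Bool → Prop}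
    (hR : ∀ (g : G) u v, R (u.1 * g, u.2) (v.1 * g, v.2) ↔ R u v)
    (hloop : ∀ v, ¬ R v v) (hcross : ∀ v, ∃ w, R v w ∧ w.2 ≠ v.2)
    {l : ℕ} (hl : 0 < l) (hdeg : ∀ v, l < outDegree R v)
    (hmin : ∀ B : Set (G × Bool), B.Nonempty → B ≠ Set.univ → l ≤ (omegaPlus R B).ncard)
    {A : Set (G × Bool)} (hne : A.Nonempty) (hA : (omegaPlus R A).ncard = l)
    (hatom : ∀ B : Set (G × Bool), B.Nonempty → B ≠ Set.univ → (omegaPlus R B).ncard = l →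
      A.ncard ≤ B.ncard)
    (hhalf : A.ncard ≤ Aᶜ.ncard) (i : Bool) :
    2 ≤ (A ∩ {p : G × Bool | p.2 = i}).ncard := by
  have hmeets : ∀ j : Bool, ∃ a, (a, j) ∈ A := by
    intro j
    by_contra! hj
    have hside : ∀ p ∈ A, p.2 ≠ j := fun p hp h => hj p.1 (h ▸ hp)
    have := le_ncard_omegaPlus_of_forall_exists hloop (d := l + 1) hdeg hne fun v hv => by
      obtain ⟨w, hvw, hw⟩ := hcross v
      refine ⟨w, hvw, fun hwA => ?_⟩
      have h1 := hside v hv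
      have h2 := hside w hwA
      revert h1 h2 hw
      cases v.2 <;> cases w.2 <;> cases j <;> simp
    omega
  obtain ⟨a, ha⟩ := hmeets i
  by_contra! hlt
  have hone : ∀ x, (x, i) ∈ A → x = a := fun x hx =>
    congrArg Prod.fst
      ((Set.ncard_le_one).1 (Nat.le_of_lt_succ hlt) (x, i) ⟨hx, rfl⟩ (a, i) ⟨ha, rfl⟩)
  obtain ⟨b, hb⟩ := hmeets (!i)
  have hother : ∀ x, (x, !i) ∈ A → x = b := by
    intro x hx
    let e : G × Bool ≃ G × Bool := (Equiv.mulRight (b⁻¹ * x)).prodCongr (Equiv.refl Bool)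
    have heA : e '' A = A := image_eq_of_inter_nonempty hmin hA hatom hhalf e
      (fun u v => hR (b⁻¹ * x) u v) ⟨(x, !i), hx, (b, !i), hb, by simp [e]⟩
    have hax : (a * (b⁻¹ * x), i) ∈ A := heA ▸ ⟨(a, i), ha, rfl⟩
    have := hone _ hax
    rw [mul_eq_left, inv_mul_eq_one] at this
    exact this.symm
  have hcard : A.ncard = 2 := by
    rw [show A = {(a, i), (b, !i)} from ?_, Set.ncard_pair (by simp)]
    ext ⟨x, j⟩
    simp only [Set.mem_insert_iff, Set.mem_singleton_iff, Prod.mk.injEq]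
    constructor
    · intro hx
      by_cases hj : j = i
      · exact Or.inl ⟨hone x (hj ▸ hx), hj⟩
      · have hj' : j = !i := by revert hj; cases i <;> cases j <;> simp
        exact Or.inr ⟨hother x (hj' ▸ hx), hj'⟩
    · rintro (⟨rfl, rfl⟩ | ⟨rfl, rfl⟩) <;> assumption
  have hmul := ncard_mul_le_ncard_omegaPlus R A l fun v hv => by
    have := outDegree_add_one_le (hloop v) hv
    have := hdeg v
    omega
  rw [hcard, hA] at hmul
  omega

theorem MDArc_mul_right_iff {G : Type*} [Group G] (S0 S1 T0 T1 : Set G) (g : G) (u v : G × Bool) :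
    MDArc S0 S1 T0 T1 (u.1 * g, u.2) (v.1 * g, v.2) ↔ MDArc S0 S1 T0 T1 u v := by
  simp [MDArc, ← mul_assoc]

theorem not_MDArc_self {G : Type*} [Group G] {S0 S1 : Set G} (T0 T1 : Set G)
    (hS0 : (1 : G) ∉ S0) (hS1 : (1 : G) ∉ S1) (v : G × Bool) : ¬ MDArc S0 S1 T0 T1 v v := by
  obtain ⟨g, _ | _⟩ := v <;> simp [MDArc, hS0, hS1]

theorem MDArc_exists_out_other_side {G : Type*} [Group G] (S0 S1 : Set G) {T0 T1 : Set G}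
    (hT0 : T0.Nonempty) (hT1 : T1.Nonempty) (v : G × Bool) :
    ∃ w, MDArc S0 S1 T0 T1 v w ∧ w.2 ≠ v.2 := by
  obtain ⟨t, ht⟩ := hT0
  obtain ⟨t', ht'⟩ := hT1
  obtain ⟨g, _ | _⟩ := v
  · exact ⟨(t * g, true), by simp [MDArc, ht], by simp⟩
  · exact ⟨(t'⁻¹ * g, false), by simpa [MDArc] using ⟨t', ht', by simp⟩, by simp⟩

theorem MDArc_exists_in_other_side {G : Type*} [Group G] (S0 S1 : Set G) {T0 T1 : Set G}
    (hT0 : T0.Nonempty) (hT1 : T1.Nonempty) (v : G × Bool) :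
    ∃ w, MDArc S0 S1 T0 T1 w v ∧ w.2 ≠ v.2 := by
  obtain ⟨t, ht⟩ := hT0
  obtain ⟨t', ht'⟩ := hT1
  obtain ⟨g, _ | _⟩ := v
  · exact ⟨(t' * g, true), by simp [MDArc, ht'], by simp⟩
  · exact ⟨(t⁻¹ * g, false), by simpa [MDArc] using ⟨t, ht, by simp⟩, by simp⟩

/-- a λ-atom meets each side `X_i = G × {i}` in at least two vertices. -/
theorem mixedCayley_lambdaAtom_meets_sides
    {G : Type*} [Group G] [Fintype G] (S0 S1 T0 T1 : Set G)
    (hS0 : (1 : G) ∉ S0) (hS1 : (1 : G) ∉ S1)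
    (hT0 : T0.Nonempty) (hT1 : T1.Nonempty)
    (hsc : DigraphStronglyConnected (MDArc S0 S1 T0 T1))
    (hlt : arcConnectivity (MDArc S0 S1 T0 T1) < minDegree (MDArc S0 S1 T0 T1))
    (A : Set (G × Bool)) (hA : IsLambdaAtom (MDArc S0 S1 T0 T1) A) :
    ∀ i : Bool, 2 ≤ (A ∩ {p : G × Bool | p.2 = i}).ncard := by
  set R := MDArc S0 S1 T0 T1
  have hcompl_ne : ∀ {B : Set (G × Bool)}, B ≠ Set.univ → Bᶜ.Nonempty := Set.nonempty_compl.2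
  have hcompl_univ : ∀ {B : Set (G × Bool)}, B.Nonempty → Bᶜ ≠ Set.univ := fun hB h =>
    hB.ne_empty (Set.compl_univ_iff.1 h)
  obtain ⟨hfrag, hatom⟩ := hA
  intro i
  rcases hfrag with ⟨hne, huniv, hcard⟩ | ⟨hne, huniv, hcard⟩
  · refine two_le_ncard_inter_side (MDArc_mul_right_iff S0 S1 T0 T1) (not_MDArc_self T0 T1 hS0 hS1)
      (MDArc_exists_out_other_side S0 S1 hT0 hT1) ?_
      (fun v => hlt.trans_le (Nat.sInf_le ⟨v, Or.inl rfl⟩))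
      (fun B => arcConnectivity_le_ncard_omegaPlus R) hne hcard
      (fun B h1 h2 h3 => hatom B (Or.inl ⟨h1, h2, h3⟩)) ?_ i
    · rw [← hcard]
      exact (Set.ncard_pos).2 (omegaPlus_nonempty hsc hne huniv)
    · refine hatom _ (Or.inr ⟨hcompl_ne huniv, hcompl_univ hne, ?_⟩)
      rw [omegaMinus_eq_omegaPlus_compl, compl_compl, hcard]
  · refine two_le_ncard_inter_side (R := flip R)
      (fun g u v => MDArc_mul_right_iff S0 S1 T0 T1 g v u) (not_MDArc_self T0 T1 hS0 hS1)
      (MDArc_exists_in_other_side S0 S1 hT0 hT1) (l := arcConnectivity R) ?_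
      (fun v => hlt.trans_le (Nat.sInf_le ⟨v, Or.inr rfl⟩))
      (fun B h1 h2 => ?_) hne
      (by rw [← ncard_omegaMinus_eq_ncard_omegaPlus_flip, hcard])
      (fun B h1 h2 h3 => hatom B (Or.inr ⟨h1, h2, ?_⟩)) ?_ i
    · rw [← hcard, omegaMinus_eq_omegaPlus_compl]
      exact (Set.ncard_pos).2 (omegaPlus_nonempty hsc (hcompl_ne huniv) (hcompl_univ hne))
    · rw [← ncard_omegaMinus_eq_ncard_omegaPlus_flip, omegaMinus_eq_omegaPlus_compl]
      exact arcConnectivity_le_ncard_omegaPlus R (hcompl_ne h2) (hcompl_univ h1)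
    · rw [ncard_omegaMinus_eq_ncard_omegaPlus_flip, h3]
    · refine hatom _ (Or.inl ⟨hcompl_ne huniv, hcompl_univ hne, ?_⟩)
      rw [← omegaMinus_eq_omegaPlus_compl, hcard]
end
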